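/- arXiv:2106.15253 — 8 statements merged into one kernel-verified Lean document; each statement's English description precedes it below -/
import Mathlib

section
/- Let A : Matrix (Fin n) (Fin n) ℝ be a matrix with nonnegative off-diagonal entries (A i j ≥ 0 for all i ≠ j) and every column summing to zero (∀ j, ∑ i, A i j = 0). If τ > 0 satisfies the time-step restriction τ * (−A j j) ≤ 1 for every j, then the explicit Euler matrix I + τ • A has all entries nonnegative and each of its columns sums to 1 (i.e. it is column-stochastic); consequently the explicit Euler step maps entrywise-nonnegative vectors to entrywise-nonnegative vectors of the same total mass. -/
open Matrix Finset

theorem explicit_euler_column_stochastic (n : ℕ) (A : Matrix (Fin n) (Fin n) ℝ)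
    (hoff : ∀ i j, i ≠ j → 0 ≤ A i j) (hcol : ∀ j, ∑ i, A i j = 0)
    (τ : ℝ) (hτ : 0 < τ) (hstep : ∀ j, τ * (-A j j) ≤ 1) :
    (∀ i j, 0 ≤ (1 + τ • A) i j) ∧ (∀ j, ∑ i, (1 + τ • A) i j = 1) ∧
    (∀ u : Fin n → ℝ, (∀ i, 0 ≤ u i) →
      (∀ i, 0 ≤ ((1 + τ • A).mulVec u) i) ∧
      ∑ i, ((1 + τ • A).mulVec u) i = ∑ i, u i) := by
  have hnonneg : ∀ i j, 0 ≤ (1 + τ • A) i j := by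
    intro i j
    rcases eq_or_ne i j with rfl | hij
    · simp only [Matrix.add_apply, Matrix.one_apply_eq, Matrix.smul_apply, smul_eq_mul]
      linarith [hstep i]
    · simpa [Matrix.one_apply_ne hij] using mul_nonneg hτ.le (hoff i j hij)
  have hsum : ∀ j, ∑ i, (1 + τ • A) i j = 1 := by
    intro j
    simp [Finset.sum_add_distrib, ← Finset.mul_sum, hcol, Matrix.one_apply]
  refine ⟨hnonneg, hsum, fun u hu => ⟨fun i => ?_, ?_⟩⟩
  · simp only [Matrix.mulVec, dotProduct]
    exact Finset.sum_nonneg fun j _ => mul_nonneg (hnonneg i j) (hu j)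
  · simp only [Matrix.mulVec, dotProduct]
    rw [Finset.sum_comm]
    simp only [← Finset.sum_mul, hsum, one_mul]
end

section
/- Let A : Matrix (Fin n) (Fin n) ℝ be a matrix with nonnegative off-diagonal entries (A i j ≥ 0 for all i ≠ j) and every column summing to zero (∀ j, ∑ i, A i j = 0). Then for every τ > 0 the matrix I − τ • A is strictly diagonally dominant by columns (for every j, ∑_{i ≠ j} |(I − τA) i j| < |(I − τA) j j|), and hence I − τ • A is invertible. -/
open Matrix Finset

theorem implicit_euler_matrix_diag_dominant_invertible (n : ℕ)
    (A : Matrix (Fin n) (Fin n) ℝ)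
    (hoff : ∀ i j, i ≠ j → 0 ≤ A i j) (hcol : ∀ j, ∑ i, A i j = 0)
    (τ : ℝ) (hτ : 0 < τ) :
    (∀ j, ∑ i ∈ Finset.univ.erase j, |(1 - τ • A) i j| < |(1 - τ • A) j j|) ∧
    IsUnit (1 - τ • A) := by
  have dominant : ∀ j, ∑ i ∈ Finset.univ.erase j, |(1 - τ • A) i j| < |(1 - τ • A) j j| := by
    intro j
    have offdiag_abs : ∑ i ∈ Finset.univ.erase j, |(1 - τ • A) i j|
        = τ * ∑ i ∈ Finset.univ.erase j, A i j := by
      rw [Finset.mul_sum]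
      refine Finset.sum_congr rfl fun i hi => ?_
      have hij : i ≠ j := Finset.ne_of_mem_erase hi
      simp [Matrix.one_apply_ne hij, abs_of_nonneg (hoff i j hij), abs_of_pos hτ]
    have col_split : A j j + ∑ i ∈ Finset.univ.erase j, A i j = 0 := by
      rw [Finset.add_sum_erase _ (fun i => A i j) (Finset.mem_univ j), hcol]
    have diag_eq : (1 - τ • A) j j = 1 + τ * ∑ i ∈ Finset.univ.erase j, A i j := by
      simp only [Matrix.sub_apply, Matrix.one_apply_eq, Matrix.smul_apply, smul_eq_mul]
      linear_combination -τ * col_split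
    rw [offdiag_abs, diag_eq]
    exact (lt_one_add _).trans_le (le_abs_self _)
  refine ⟨dominant, (Matrix.isUnit_iff_isUnit_det _).mpr (isUnit_iff_ne_zero.mpr ?_)⟩
  exact det_ne_zero_of_sum_col_lt_diag fun j => by simpa only [Real.norm_eq_abs] using dominant j
end

section
/- Let A : Matrix (Fin n) (Fin n) ℝ be a matrix with nonnegative off-diagonal entries (A i j ≥ 0 for all i ≠ j) and every column summing to zero (∀ j, ∑ i, A i j = 0), and let τ > 0. Then every column of the inverse matrix (I − τ • A)⁻¹ sums to 1; consequently the implicit Euler step conserves mass: for every u : Fin n → ℝ, ∑ i, ((I − τ • A)⁻¹.mulVec u) i = ∑ i, u i. -/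
open Matrix Finset

/-- If the off-diagonal entries of `A` are nonnegative and its columns sum to zero, then
`1 - τ • A` is strictly diagonally dominant by columns, hence invertible. -/
theorem isUnit_det_one_sub_smul {ι : Type*} [Fintype ι] [DecidableEq ι] {A : Matrix ι ι ℝ}
    (hoff : ∀ i j, i ≠ j → 0 ≤ A i j) (hcol : ∀ j, ∑ i, A i j = 0) {τ : ℝ} (hτ : 0 ≤ τ) :
    IsUnit (1 - τ • A).det := by
  refine isUnit_iff_ne_zero.mpr (det_ne_zero_of_sum_col_lt_diag fun k => ?_)
  have hsum : ∑ i ∈ univ.erase k, ‖(1 - τ • A) i k‖ = τ * ∑ i ∈ univ.erase k, A i k := by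
    rw [mul_sum]
    refine sum_congr rfl fun i hi => ?_
    have hik := ne_of_mem_erase hi
    simp [hik, abs_of_nonneg hτ, abs_of_nonneg (hoff i k hik)]
  have hdiag : (1 - τ • A) k k = 1 - τ * A k k := by simp
  rw [hsum, sum_erase_eq_sub (mem_univ k), hcol k, hdiag]
  refine lt_of_lt_of_le ?_ (le_abs_self _)
  linarith

/-- The inverse of an invertible matrix with unit column sums has unit column sums. -/
theorem one_vecMul_inv_of_one_vecMul {ι R : Type*} [Fintype ι] [DecidableEq ι] [CommRing R]
    {M : Matrix ι ι R} (hM : IsUnit M.det) (h : 1 ᵥ* M = 1) : 1 ᵥ* M⁻¹ = 1 := by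
  conv_lhs => rw [← h]
  rw [vecMul_vecMul, mul_nonsing_inv _ hM, vecMul_one]

theorem implicit_euler_mass_conservation (n : ℕ) (A : Matrix (Fin n) (Fin n) ℝ)
    (hoff : ∀ i j, i ≠ j → 0 ≤ A i j) (hcol : ∀ j, ∑ i, A i j = 0)
    (τ : ℝ) (hτ : 0 < τ) :
    (∀ j, ∑ i, (1 - τ • A)⁻¹ i j = 1) ∧
    (∀ u : Fin n → ℝ, ∑ i, ((1 - τ • A)⁻¹.mulVec u) i = ∑ i, u i) := by
  have hA : 1 ᵥ* A = 0 := by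
    ext j
    simpa [vecMul, dotProduct] using hcol j
  have hinv : 1 ᵥ* (1 - τ • A)⁻¹ = 1 :=
    one_vecMul_inv_of_one_vecMul (isUnit_det_one_sub_smul hoff hcol hτ.le) (by
      rw [vecMul_sub, vecMul_smul, hA, vecMul_one, smul_zero, sub_zero])
  refine ⟨fun j => ?_, fun u => ?_⟩
  · simpa [vecMul, dotProduct] using congrFun hinv j
  · rw [← one_dotProduct, dotProduct_mulVec, hinv, one_dotProduct]
end

section
/- Let A : Matrix (Fin n) (Fin n) ℝ be a matrix with nonnegative off-diagonal entries (A i j ≥ 0 for all i ≠ j) and every column summing to zero (∀ j, ∑ i, A i j = 0), and let τ > 0. Then every entry of (I − τ • A)⁻¹ is nonnegative; consequently the implicit Euler step preserves nonnegativity: if u : Fin n → ℝ has u i ≥ 0 for all i, then ((I − τ • A)⁻¹.mulVec u) i ≥ 0 for all i. -/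
open Matrix Finset

/-- A matrix with nonpositive off-diagonal entries and positive column sums is monotone
with respect to multiplication by row vectors. -/
theorem nonneg_of_vecMul_nonneg {ι : Type*} [Fintype ι] {M : Matrix ι ι ℝ}
    (hoff : ∀ i j, i ≠ j → M i j ≤ 0) (hcol : ∀ j, 0 < ∑ i, M i j)
    {v : ι → ℝ} (hv : ∀ j, 0 ≤ (v ᵥ* M) j) (i : ι) : 0 ≤ v i := by
  obtain ⟨m, -, hm⟩ := univ.exists_min_image v ⟨i, mem_univ i⟩
  refine le_trans ?_ (hm i (mem_univ i))
  have hle : (v ᵥ* M) m ≤ v m * ∑ k, M k m := by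
    rw [Finset.mul_sum]
    refine Finset.sum_le_sum fun k _ => ?_
    rcases eq_or_ne k m with rfl | hk
    · exact le_rfl
    · exact mul_le_mul_of_nonpos_right (hm k (mem_univ k)) (hoff k m hk)
  exact nonneg_of_mul_nonneg_left ((hv m).trans hle) (hcol m)

/-- The inverse of a matrix with nonpositive off-diagonal entries and positive column sums is
entrywise nonnegative. -/
theorem inv_nonneg_of_offDiag_nonpos {ι : Type*} [Fintype ι] [DecidableEq ι] {M : Matrix ι ι ℝ}
    (hoff : ∀ i j, i ≠ j → M i j ≤ 0) (hcol : ∀ j, 0 < ∑ i, M i j) (i j : ι) :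
    0 ≤ M⁻¹ i j := by
  have hdet : IsUnit M.det := by
    refine isUnit_iff_ne_zero.2 (det_ne_zero_of_sum_col_lt_diag fun k => ?_)
    have hsum := hcol k
    rw [← Finset.add_sum_erase _ _ (mem_univ k)] at hsum
    have habs : ∑ l ∈ univ.erase k, ‖M l k‖ = -∑ l ∈ univ.erase k, M l k := by
      rw [← Finset.sum_neg_distrib]
      exact Finset.sum_congr rfl fun l hl => abs_of_nonpos (hoff l k (ne_of_mem_erase hl))
    rw [habs]
    exact lt_of_lt_of_le (by linarith) (le_abs_self (M k k))
  refine nonneg_of_vecMul_nonneg hoff hcol (v := M⁻¹ i) (fun k => ?_) j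
  have hrow : (M⁻¹ i ᵥ* M) k = (1 : Matrix ι ι ℝ) i k := by
    rw [← nonsing_inv_mul M hdet]
    rfl
  rw [hrow, one_apply]
  split_ifs <;> norm_num

theorem implicit_euler_positivity_preservation (n : ℕ) (A : Matrix (Fin n) (Fin n) ℝ)
    (hoff : ∀ i j, i ≠ j → 0 ≤ A i j) (hcol : ∀ j, ∑ i, A i j = 0)
    (τ : ℝ) (hτ : 0 < τ) :
    (∀ i j, 0 ≤ (1 - τ • A)⁻¹ i j) ∧
    (∀ u : Fin n → ℝ, (∀ i, 0 ≤ u i) → ∀ i, 0 ≤ ((1 - τ • A)⁻¹.mulVec u) i) := by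
  have hinv : ∀ i j, 0 ≤ (1 - τ • A)⁻¹ i j := by
    refine inv_nonneg_of_offDiag_nonpos (fun i j hij => ?_) fun j => ?_
    · simpa [one_apply_ne hij] using mul_nonneg hτ.le (hoff i j hij)
    · simp [Finset.sum_sub_distrib, ← Finset.mul_sum, hcol, one_apply]
  exact ⟨hinv, fun u hu i => dotProduct_nonneg_of_nonneg (hinv i) hu⟩
end

section
/- Let A : Matrix (Fin n) (Fin n) ℝ be a matrix with nonnegative off-diagonal entries (A i j ≥ 0 for all i ≠ j), every column summing to zero (∀ j, ∑ i, A i j = 0), and A irreducible, meaning: for every pair of indices i ≠ j there exist m ≥ 1 and indices i = i₀, i₁, …, i_m = j with A i_{k+1} i_k ≠ 0 for all 0 ≤ k < m. Then for every τ > 0 every entry of (I − τ • A)⁻¹ is strictly positive; consequently if u : Fin n → ℝ is entrywise nonnegative and not identically zero, then (I − τ • A)⁻¹.mulVec u is entrywise strictly positive. -/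
open Matrix Finset

section ImplicitEuler

variable {ι : Type*} [Fintype ι] [DecidableEq ι] {A : Matrix ι ι ℝ} {τ : ℝ}

theorem one_sub_smul_mulVec_apply (A : Matrix ι ι ℝ) (τ : ℝ) (x : ι → ℝ) (i : ι) :
    ((1 - τ • A) *ᵥ x) i = x i - τ * ∑ j, A i j * x j := by
  rw [sub_mulVec, one_mulVec, smul_mulVec]
  rfl

theorem nonneg_of_one_sub_smul_mulVec_nonneg (hoff : ∀ i j, i ≠ j → 0 ≤ A i j)
    (hcol : ∀ j, ∑ i, A i j = 0) (hτ : 0 ≤ τ) {x : ι → ℝ}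
    (h : ∀ i, 0 ≤ ((1 - τ • A) *ᵥ x) i) (i : ι) : 0 ≤ x i := by
  by_contra! hi
  set N : Finset ι := univ.filter fun k => x k < 0 with hN
  have hsum : 0 ≤ ∑ k ∈ N, ((1 - τ • A) *ᵥ x) k := sum_nonneg fun k _ => h k
  simp only [one_sub_smul_mulVec_apply, sum_sub_distrib, ← mul_sum] at hsum
  have hflux : 0 ≤ ∑ k ∈ N, ∑ j, A k j * x j := by
    rw [sum_comm]
    refine sum_nonneg fun j _ => ?_
    rw [← sum_mul]
    by_cases hj : x j < 0
    · refine mul_nonneg_of_nonpos_of_nonpos ?_ hj.le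
      have hcompl : 0 ≤ ∑ k ∈ Nᶜ, A k j := sum_nonneg fun k hk => hoff k j <| by
        rintro rfl
        simp [hN, hj.not_ge] at hk
      linarith [sum_add_sum_compl N fun k => A k j, hcol j]
    · refine mul_nonneg (sum_nonneg fun k hk => hoff k j ?_) (not_lt.mp hj)
      rintro rfl
      exact hj (by simpa [hN] using hk)
  have hneg : ∑ k ∈ N, x k < 0 :=
    sum_neg (fun k hk => by simpa [hN] using hk) ⟨i, by simpa [hN] using hi⟩
  linarith [mul_nonneg hτ hflux]

theorem isUnit_one_sub_smul (hoff : ∀ i j, i ≠ j → 0 ≤ A i j)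
    (hcol : ∀ j, ∑ i, A i j = 0) (hτ : 0 ≤ τ) : IsUnit (1 - τ • A) := by
  rw [← mulVec_injective_iff_isUnit]
  intro x y hxy
  have key : ∀ v w : ι → ℝ, (1 - τ • A) *ᵥ v = (1 - τ • A) *ᵥ w → ∀ i, w i ≤ v i := by
    intro v w hvw i
    have := nonneg_of_one_sub_smul_mulVec_nonneg hoff hcol hτ (x := v - w)
      (fun k => by rw [mulVec_sub, hvw, sub_self]; rfl) i
    simpa using this
  exact funext fun i => le_antisymm (key y x hxy.symm i) (key x y hxy i)

theorem pos_of_one_sub_smul_mulVec_nonneg (hoff : ∀ i j, i ≠ j → 0 ≤ A i j)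
    (hτ : 0 < τ) {x : ι → ℝ} (hx : ∀ i, 0 ≤ x i)
    (h : ∀ i, 0 ≤ ((1 - τ • A) *ᵥ x) i) {i : ι}
    (hi : 0 < ((1 - τ • A) *ᵥ x) i ∨ ∃ j, A i j ≠ 0 ∧ 0 < x j) : 0 < x i := by
  refine (hx i).lt_of_ne' fun hxi => ?_
  have hterm : ∀ j ∈ univ, 0 ≤ A i j * x j := fun j _ => by
    by_cases hij : i = j
    · simp [← hij, hxi]
    · exact mul_nonneg (hoff i j hij) (hx j)
  have heq := one_sub_smul_mulVec_apply A τ x i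
  have hnonneg := mul_nonneg hτ.le (sum_nonneg hterm)
  rcases hi with hi | ⟨j, hAij, hxj⟩
  · linarith
  · have hij : i ≠ j := by
      rintro rfl
      exact hxj.ne' hxi
    have hpos : 0 < ∑ j, A i j * x j :=
      sum_pos' hterm ⟨j, mem_univ j, mul_pos ((hoff i j hij).lt_of_ne' hAij) hxj⟩
    linarith [mul_pos hτ hpos, h i]

end ImplicitEuler

theorem implicit_euler_strict_positivity (n : ℕ) (A : Matrix (Fin n) (Fin n) ℝ)
    (hoff : ∀ i j, i ≠ j → 0 ≤ A i j) (hcol : ∀ j, ∑ i, A i j = 0)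
    (hirr : ∀ i j : Fin n, i ≠ j → ∃ m : ℕ, 1 ≤ m ∧ ∃ p : Fin (m + 1) → Fin n,
      p 0 = i ∧ p (Fin.last m) = j ∧ ∀ k : Fin m, A (p k.succ) (p k.castSucc) ≠ 0)
    (τ : ℝ) (hτ : 0 < τ) :
    (∀ i j, 0 < (1 - τ • A)⁻¹ i j) ∧
    (∀ u : Fin n → ℝ, (∀ i, 0 ≤ u i) → u ≠ 0 →
      ∀ i, 0 < ((1 - τ • A)⁻¹.mulVec u) i) := by
  have hdet := (isUnit_iff_isUnit_det _).mp (isUnit_one_sub_smul hoff hcol hτ.le)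
  have hpos : ∀ u : Fin n → ℝ, (∀ i, 0 ≤ u i) → u ≠ 0 →
      ∀ i, 0 < ((1 - τ • A)⁻¹.mulVec u) i := by
    intro u hu hu0 i
    set x := (1 - τ • A)⁻¹ *ᵥ u with hx_def
    have hx : (1 - τ • A) *ᵥ x = u := by
      rw [hx_def, mulVec_mulVec, mul_nonsing_inv _ hdet, one_mulVec]
    have hBx : ∀ i, 0 ≤ ((1 - τ • A) *ᵥ x) i := by rwa [hx]
    have hx0 := nonneg_of_one_sub_smul_mulVec_nonneg hoff hcol hτ.le hBx
    obtain ⟨j, hj⟩ := Function.ne_iff.mp hu0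
    have hxj : 0 < x j := pos_of_one_sub_smul_mulVec_nonneg hoff hτ hx0 hBx
      (Or.inl (by rw [hx]; exact (hu j).lt_of_ne' hj))
    by_cases hji : j = i
    · rwa [← hji]
    · obtain ⟨m, -, p, hp0, hpm, hp⟩ := hirr j i hji
      have hpath : ∀ k, 0 < x (p k) := fun k => by
        induction k using Fin.induction with
        | zero => rwa [hp0]
        | succ k ih =>
          exact pos_of_one_sub_smul_mulVec_nonneg hoff hτ hx0 hBx (Or.inr ⟨_, hp k, ih⟩)
      simpa [hpm] using hpath (Fin.last m)
  refine ⟨fun i j => ?_, hpos⟩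
  have hsingle : (0 : Fin n → ℝ) ≤ Pi.single j 1 := Pi.single_nonneg.mpr zero_le_one
  simpa using hpos (Pi.single j 1) hsingle (by simp) i
end

section
/- Let A : Matrix (Fin n) (Fin n) ℝ be a matrix with nonnegative off-diagonal entries (A i j ≥ 0 for all i ≠ j) and every column summing to zero (∀ j, ∑ i, A i j = 0), and let τ > 0. Then the implicit Euler step is nonexpansive in the ℓ¹ norm: for every u : Fin n → ℝ, ∑ i, |((I − τ • A)⁻¹.mulVec u) i| ≤ ∑ i, |u i|. -/
open Matrix Finset

/-- For a matrix with nonnegative off-diagonal entries, `|v i| - (A |v|) i` is dominated by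
`|(v - A v) i|`. -/
theorem abs_le_abs_one_sub_mulVec_add {ι : Type*} [Fintype ι] [DecidableEq ι]
    {A : Matrix ι ι ℝ} (hoff : ∀ i j, i ≠ j → 0 ≤ A i j) (v : ι → ℝ) (i : ι) :
    |v i| ≤ |((1 - A) *ᵥ v) i| + ∑ j, A i j * |v j| := by
  have hw : ((1 - A) *ᵥ v) i = v i - ∑ j, A i j * v j := by
    rw [sub_mulVec, one_mulVec]
    rfl
  rw [hw]
  rcases le_total 0 (v i) with hi | hi
  · have hsum : ∑ j, A i j * v j ≤ ∑ j, A i j * |v j| := by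
      refine sum_le_sum fun j _ => ?_
      rcases eq_or_ne i j with rfl | hij
      · rw [abs_of_nonneg hi]
      · exact mul_le_mul_of_nonneg_left (le_abs_self _) (hoff i j hij)
    rw [abs_of_nonneg hi]
    linarith [le_abs_self (v i - ∑ j, A i j * v j)]
  · have hsum : -∑ j, A i j * v j ≤ ∑ j, A i j * |v j| := by
      rw [← sum_neg_distrib]
      refine sum_le_sum fun j _ => ?_
      rw [← mul_neg]
      rcases eq_or_ne i j with rfl | hij
      · rw [abs_of_nonpos hi]
      · exact mul_le_mul_of_nonneg_left (neg_le_abs _) (hoff i j hij)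
    rw [abs_of_nonpos hi]
    linarith [neg_le_abs (v i - ∑ j, A i j * v j)]

/-- If `A` has nonnegative off-diagonal entries and zero column sums, then `1 - A` does not
decrease the `ℓ¹` norm. -/
theorem sum_abs_le_sum_abs_one_sub_mulVec {ι : Type*} [Fintype ι] [DecidableEq ι]
    {A : Matrix ι ι ℝ} (hoff : ∀ i j, i ≠ j → 0 ≤ A i j) (hcol : ∀ j, ∑ i, A i j = 0)
    (v : ι → ℝ) : ∑ i, |v i| ≤ ∑ i, |((1 - A) *ᵥ v) i| := by
  have hzero : ∑ i, ∑ j, A i j * |v j| = 0 := by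
    rw [sum_comm]
    simp [← sum_mul, hcol]
  calc ∑ i, |v i| ≤ ∑ i, (|((1 - A) *ᵥ v) i| + ∑ j, A i j * |v j|) :=
        sum_le_sum fun i _ => abs_le_abs_one_sub_mulVec_add hoff v i
    _ = ∑ i, |((1 - A) *ᵥ v) i| := by rw [sum_add_distrib, hzero, add_zero]

theorem implicit_euler_l1_nonexpansive (n : ℕ) (A : Matrix (Fin n) (Fin n) ℝ)
    (hoff : ∀ i j, i ≠ j → 0 ≤ A i j) (hcol : ∀ j, ∑ i, A i j = 0)
    (τ : ℝ) (hτ : 0 < τ) (u : Fin n → ℝ) :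
    ∑ i, |((1 - τ • A)⁻¹.mulVec u) i| ≤ ∑ i, |u i| := by
  have hexp := sum_abs_le_sum_abs_one_sub_mulVec (A := τ • A)
    (fun i j hij => mul_nonneg hτ.le (hoff i j hij))
    (fun j => by simp [← mul_sum, hcol])
  have hinj : Function.Injective (1 - τ • A).mulVec := by
    refine (injective_iff_map_eq_zero (1 - τ • A).mulVecLin).mpr fun v hv => ?_
    have hv' : (1 - τ • A) *ᵥ v = 0 := hv
    have hle := hexp v
    simp only [hv', Pi.zero_apply, abs_zero, sum_const_zero] at hle
    funext i
    exact abs_nonpos_iff.mp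
      ((single_le_sum (fun j _ => abs_nonneg (v j)) (mem_univ i)).trans hle)
  have hdet : IsUnit (1 - τ • A).det :=
    (isUnit_iff_isUnit_det _).mp (mulVec_injective_iff_isUnit.mp hinj)
  have hle := hexp ((1 - τ • A)⁻¹ *ᵥ u)
  rwa [mulVec_mulVec, mul_nonsing_inv _ hdet, one_mulVec] at hle
end

section
/- Let A₁, A₂ : Matrix (Fin n) (Fin n) ℝ each have nonnegative off-diagonal entries (Aₘ i j ≥ 0 for all i ≠ j) and every column summing to zero (∀ j, ∑ i, Aₘ i j = 0), for m = 1, 2, and let τ > 0. Then the multiplicative operator splitting (MOS) step u ↦ (I − τ • A₂)⁻¹.mulVec ((I − τ • A₁)⁻¹.mulVec u) conserves mass (the sum of the entries of the output equals the sum of the entries of the input) and preserves nonnegativity (if u is entrywise nonnegative then so is the output). -/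
open Matrix Finset

/-- A matrix with nonpositive off-diagonal entries and unit column sums is monotone:
`0 ≤ M v` implies `0 ≤ v`. -/
theorem nonneg_of_mulVec_nonneg {ι : Type*} [Fintype ι] {M : Matrix ι ι ℝ}
    (hoff : ∀ i j, i ≠ j → M i j ≤ 0) (hcol : ∀ j, ∑ i, M i j = 1)
    {v : ι → ℝ} (hv : ∀ i, 0 ≤ (M *ᵥ v) i) (i : ι) : 0 ≤ v i := by
  classical
  by_contra! hi
  let N : Finset ι := {k | v k < 0}
  have mem_N (k : ι) : k ∈ N ↔ v k < 0 := by simp [N]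
  have hswap : ∑ k ∈ N, (M *ᵥ v) k = ∑ j, (∑ k ∈ N, M k j) * v j := by
    simp only [mulVec, dotProduct, Finset.sum_mul]
    exact Finset.sum_comm
  have hterm (j : ι) : (∑ k ∈ N, M k j) * v j ≤ if j ∈ N then v j else 0 := by
    split_ifs with hj
    · have hsplit := Finset.sum_add_sum_compl N fun k => M k j
      have hcompl : ∑ k ∈ Nᶜ, M k j ≤ 0 := Finset.sum_nonpos fun k hk =>
        hoff k j fun hkj => Finset.mem_compl.1 hk (hkj ▸ hj)
      have hle : 1 ≤ ∑ k ∈ N, M k j := by linarith [hcol j]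
      nlinarith [(mem_N j).1 hj]
    · refine mul_nonpos_of_nonpos_of_nonneg ?_ (not_lt.1 fun h => hj ((mem_N j).2 h))
      exact Finset.sum_nonpos fun k hk => hoff k j fun hkj => hj (hkj ▸ hk)
  have hle : ∑ k ∈ N, (M *ᵥ v) k ≤ ∑ j ∈ N, v j := by
    rw [hswap]
    simpa using Finset.sum_le_sum fun j (_ : j ∈ univ) => hterm j
  have hneg : ∑ j ∈ N, v j < 0 :=
    Finset.sum_neg (fun j hj => (mem_N j).1 hj) ⟨i, (mem_N i).2 hi⟩
  linarith [Finset.sum_nonneg fun k (_ : k ∈ N) => hv k]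

theorem isUnit_of_offDiag_nonpos_of_sum_col_eq_one {ι : Type*} [Fintype ι] [DecidableEq ι]
    {M : Matrix ι ι ℝ} (hoff : ∀ i j, i ≠ j → M i j ≤ 0) (hcol : ∀ j, ∑ i, M i j = 1) :
    IsUnit M := by
  rw [← mulVec_injective_iff_isUnit]
  intro v w hvw
  have hvw : M *ᵥ v = M *ᵥ w := hvw
  ext i
  have h₁ := nonneg_of_mulVec_nonneg hoff hcol (v := v - w) (by simp [mulVec_sub, hvw]) i
  have h₂ := nonneg_of_mulVec_nonneg hoff hcol (v := w - v) (by simp [mulVec_sub, hvw]) i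
  simp only [Pi.sub_apply] at h₁ h₂
  linarith

/-- One implicit Euler step conserves mass and preserves nonnegativity. -/
theorem implicitEuler_mass_conservation_positivity {ι : Type*} [Fintype ι] [DecidableEq ι]
    {A : Matrix ι ι ℝ} (hoff : ∀ i j, i ≠ j → 0 ≤ A i j) (hcol : ∀ j, ∑ i, A i j = 0)
    {τ : ℝ} (hτ : 0 ≤ τ) (u : ι → ℝ) :
    ∑ i, ((1 - τ • A)⁻¹ *ᵥ u) i = ∑ i, u i ∧
    ((∀ i, 0 ≤ u i) → ∀ i, 0 ≤ ((1 - τ • A)⁻¹ *ᵥ u) i) := by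
  have hoffM (i j : ι) (hij : i ≠ j) : (1 - τ • A) i j ≤ 0 := by
    simpa [one_apply_ne hij] using mul_nonneg hτ (hoff i j hij)
  have hcolM (j : ι) : ∑ i, (1 - τ • A) i j = 1 := by
    simp [Finset.sum_sub_distrib, ← Finset.mul_sum, hcol, one_apply]
  have hdet := (isUnit_iff_isUnit_det _).1
    (isUnit_of_offDiag_nonpos_of_sum_col_eq_one hoffM hcolM)
  have hsolve : (1 - τ • A) *ᵥ ((1 - τ • A)⁻¹ *ᵥ u) = u := by
    rw [mulVec_mulVec, mul_nonsing_inv _ hdet, one_mulVec]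
  refine ⟨?_, fun hu => nonneg_of_mulVec_nonneg hoffM hcolM (by rwa [hsolve])⟩
  conv_rhs => rw [← hsolve]
  generalize (1 - τ • A)⁻¹ *ᵥ u = v
  simp only [mulVec, dotProduct]
  rw [Finset.sum_comm]
  simp only [← Finset.sum_mul, hcolM, one_mul]

theorem MOS_mass_conservation_positivity (n : ℕ)
    (A₁ A₂ : Matrix (Fin n) (Fin n) ℝ)
    (hoff₁ : ∀ i j, i ≠ j → 0 ≤ A₁ i j) (hcol₁ : ∀ j, ∑ i, A₁ i j = 0)
    (hoff₂ : ∀ i j, i ≠ j → 0 ≤ A₂ i j) (hcol₂ : ∀ j, ∑ i, A₂ i j = 0)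
    (τ : ℝ) (hτ : 0 < τ) (u : Fin n → ℝ) :
    ∑ i, ((1 - τ • A₂)⁻¹.mulVec ((1 - τ • A₁)⁻¹.mulVec u)) i = ∑ i, u i ∧
    ((∀ i, 0 ≤ u i) →
      ∀ i, 0 ≤ ((1 - τ • A₂)⁻¹.mulVec ((1 - τ • A₁)⁻¹.mulVec u)) i) := by
  have h₁ := implicitEuler_mass_conservation_positivity hoff₁ hcol₁ hτ.le u
  have h₂ := implicitEuler_mass_conservation_positivity hoff₂ hcol₂ hτ.le
    ((1 - τ • A₁)⁻¹ *ᵥ u)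
  exact ⟨h₂.1.trans h₁.1, fun hu => h₂.2 (h₁.2 hu)⟩
end

section
/- Let A : Matrix (Fin n) (Fin n) ℝ be a matrix with nonnegative off-diagonal entries (A i j ≥ 0 for all i ≠ j) and every column summing to zero (∀ j, ∑ i, A i j = 0). Then every eigenvalue of A has nonpositive real part: if λ ∈ ℂ and there exists a nonzero vector z : Fin n → ℂ with (A.map (Complex.ofReal)).mulVec z = λ • z, then λ.re ≤ 0. -/
open Matrix Finset

theorem eigenvalues_nonpositive_real_part (n : ℕ) (A : Matrix (Fin n) (Fin n) ℝ)
    (hoff : ∀ i j, i ≠ j → 0 ≤ A i j) (hcol : ∀ j, ∑ i, A i j = 0)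
    (lam : ℂ) (z : Fin n → ℂ) (hz : z ≠ 0)
    (heig : (A.map (Complex.ofReal)).mulVec z = lam • z) :
    lam.re ≤ 0 := by
  by_contra! hlam
  have hker : (A.map Complex.ofReal - lam • (1 : Matrix (Fin n) (Fin n) ℂ)) *ᵥ z = 0 := by
    rw [sub_mulVec, heig, smul_mulVec, one_mulVec, sub_self]
  refine det_ne_zero_of_sum_col_lt_diag (fun k => ?_)
    (exists_mulVec_eq_zero_iff.mp ⟨z, hz, hker⟩)
  have hsum : ∑ i ∈ univ.erase k,
      ‖(A.map Complex.ofReal - lam • (1 : Matrix (Fin n) (Fin n) ℂ)) i k‖ = -A k k := by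
    rw [← sub_eq_zero, sub_neg_eq_add, ← hcol k, ← sum_erase_add univ _ (mem_univ k)]
    congr 1
    refine sum_congr rfl fun i hi => ?_
    have hik := ne_of_mem_erase hi
    simp [one_apply_ne hik, abs_of_nonneg (hoff i k hik)]
  rw [hsum]
  calc -A k k < -(A k k - lam.re) := by linarith
    _ ≤ |A k k - lam.re| := neg_le_abs _
    _ = |((A.map Complex.ofReal - lam • (1 : Matrix (Fin n) (Fin n) ℂ)) k k).re| := by simp
    _ ≤ _ := Complex.abs_re_le_norm _
end
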